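/- arXiv:solv-int/9707010 — 12 statements merged into one kernel-verified Lean document; each statement's English description precedes it below -/
import Mathlib

section
/- Let u : ℝ → ℂ be differentiable with derivative u_x, let z ∈ ℂ, and let F, G, H : ℝ → ℂ be differentiable functions satisfying for all x ∈ ℝ: F_x = −i u_x F − 2 i z G, H_x = i u_x H + 2 i z G, and G_x = i (H − F). Then the function x ↦ z·G(x)² + F(x)·H(x) has vanishing derivative on ℝ; in particular there exists a constant P ∈ ℂ with z·G(x)² + F(x)·H(x) = P for all x ∈ ℝ. -/
open Complex

/-- For solutions of the stationary system, `z G² + F H` is constant. -/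
theorem stationary_first_integral
    (u ux F Fx G Gx H Hx : ℝ → ℂ) (z : ℂ)
    (hu : ∀ x : ℝ, HasDerivAt u (ux x) x)
    (hF : ∀ x : ℝ, HasDerivAt F (Fx x) x)
    (hG : ∀ x : ℝ, HasDerivAt G (Gx x) x)
    (hH : ∀ x : ℝ, HasDerivAt H (Hx x) x)
    (h1 : ∀ x : ℝ, Fx x = -I * ux x * F x - 2 * I * z * G x)
    (h2 : ∀ x : ℝ, Hx x = I * ux x * H x + 2 * I * z * G x)
    (h3 : ∀ x : ℝ, Gx x = I * (H x - F x)) :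
    (∀ x : ℝ, HasDerivAt (fun y : ℝ => z * G y ^ 2 + F y * H y) 0 x) ∧
      ∃ P : ℂ, ∀ x : ℝ, z * G x ^ 2 + F x * H x = P := by
  have key : ∀ x : ℝ, HasDerivAt (fun y : ℝ => z * G y ^ 2 + F y * H y) 0 x := by
    intro x
    refine ((((hG x).fun_pow 2).const_mul z).fun_add ((hF x).fun_mul (hH x))).congr_deriv ?_
    rw [h1, h2, h3]
    push_cast
    ring
  exact ⟨key, _, fun x => is_const_of_deriv_eq_zero (fun y => (key y).differentiableAt)
    (fun y => (key y).deriv) x 0⟩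
end

section
/- Let u : ℝ → ℂ be twice differentiable, let z, P ∈ ℂ, and let F, G, H : ℝ → ℂ be differentiable functions satisfying for all x ∈ ℝ: F_x = −i u_x F − 2 i z G, H_x = i u_x H + 2 i z G, G_x = i (H − F), and z·G(x)² + F(x)·H(x) = P. Then F is twice differentiable and for all x ∈ ℝ: F(x)·F_xx(x) − (1/2)·F_x(x)² + (2z + (1/2)·u_x(x)² + i·u_xx(x))·F(x)² = 2 z P. -/
open Complex

/-- The second-order equation `F F_xx - F_x²/2 + (2z + u_x²/2 + i u_xx) F² = 2 z P`
for solutions of the stationary system with first integral `P`. -/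
theorem stationary_second_order_F
    (u ux uxx F Fx G Gx H Hx : ℝ → ℂ) (z P : ℂ)
    (hu : ∀ x : ℝ, HasDerivAt u (ux x) x)
    (hux : ∀ x : ℝ, HasDerivAt ux (uxx x) x)
    (hF : ∀ x : ℝ, HasDerivAt F (Fx x) x)
    (hG : ∀ x : ℝ, HasDerivAt G (Gx x) x)
    (hH : ∀ x : ℝ, HasDerivAt H (Hx x) x)
    (h1 : ∀ x : ℝ, Fx x = -I * ux x * F x - 2 * I * z * G x)
    (h2 : ∀ x : ℝ, Hx x = I * ux x * H x + 2 * I * z * G x)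
    (h3 : ∀ x : ℝ, Gx x = I * (H x - F x))
    (hP : ∀ x : ℝ, z * G x ^ 2 + F x * H x = P) :
    ∃ Fxx : ℝ → ℂ, (∀ x : ℝ, HasDerivAt Fx (Fxx x) x) ∧
      ∀ x : ℝ, F x * Fxx x - (1 / 2) * Fx x ^ 2 +
        (2 * z + (1 / 2) * ux x ^ 2 + I * uxx x) * F x ^ 2 = 2 * z * P := by
  refine ⟨fun x => -I * uxx x * F x + -I * ux x * Fx x - 2 * I * z * Gx x, fun x => ?_,
    fun x => ?_⟩
  · have h := (((hux x).const_mul (-I)).mul (hF x)).sub ((hG x).const_mul (2 * I * z))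
    exact h.congr_of_eventuallyEq (.of_forall h1)
  · simp only [h3 x, h1 x, ← hP x]
    linear_combination
      (ux x ^ 2 * F x ^ 2 / 2 - 2 * z ^ 2 * G x ^ 2 - 2 * z * F x * H x + 2 * z * F x ^ 2) * I_sq
end

section
/- Let u : ℝ → ℂ be three times differentiable, let z ∈ ℂ, and let F, G, H : ℝ → ℂ be differentiable functions satisfying for all x ∈ ℝ: F_x = −i u_x F − 2 i z G, H_x = i u_x H + 2 i z G, and G_x = i (H − F). Assume moreover that F(x) ≠ 0 for all x ∈ ℝ. Then F is three times differentiable and satisfies the third-order linear differential equation F_xxx(x) + (4z + u_x(x)² + 2 i u_xx(x))·F_x(x) + (u_x(x)·u_xx(x) + i·u_xxx(x))·F(x) = 0 for all x ∈ ℝ. -/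
open Complex

/-- The third-order linear differential equation satisfied by `F`. -/
theorem stationary_third_order_F
    (u ux uxx uxxx F Fx G Gx H Hx : ℝ → ℂ) (z : ℂ)
    (hu : ∀ x : ℝ, HasDerivAt u (ux x) x)
    (hux : ∀ x : ℝ, HasDerivAt ux (uxx x) x)
    (huxx : ∀ x : ℝ, HasDerivAt uxx (uxxx x) x)
    (hF : ∀ x : ℝ, HasDerivAt F (Fx x) x)
    (hG : ∀ x : ℝ, HasDerivAt G (Gx x) x)
    (hH : ∀ x : ℝ, HasDerivAt H (Hx x) x)
    (h1 : ∀ x : ℝ, Fx x = -I * ux x * F x - 2 * I * z * G x)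
    (h2 : ∀ x : ℝ, Hx x = I * ux x * H x + 2 * I * z * G x)
    (h3 : ∀ x : ℝ, Gx x = I * (H x - F x))
    (hFne : ∀ x : ℝ, F x ≠ 0) :
    ∃ Fxx Fxxx : ℝ → ℂ,
      (∀ x : ℝ, HasDerivAt Fx (Fxx x) x) ∧
      (∀ x : ℝ, HasDerivAt Fxx (Fxxx x) x) ∧
      ∀ x : ℝ, Fxxx x + (4 * z + ux x ^ 2 + 2 * I * uxx x) * Fx x +
        (ux x * uxx x + I * uxxx x) * F x = 0 := by
  have hFx : ∀ x : ℝ, HasDerivAt Fx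
      (-I * uxx x * F x - I * ux x * Fx x + 2 * z * (H x - F x)) x := by
    intro x
    have h := (((hux x).const_mul (-I)).mul (hF x)).sub ((hG x).const_mul (2 * I * z))
    refine (h.congr_of_eventuallyEq (.of_forall h1)).congr_deriv ?_
    rw [h3]
    linear_combination (-2 * z * (H x - F x)) * I_sq
  have hFxx : ∀ x : ℝ, HasDerivAt
      (fun y ↦ -I * uxx y * F y - I * ux y * Fx y + 2 * z * (H y - F y))
      (-(4 * z + ux x ^ 2 + 2 * I * uxx x) * Fx x - (ux x * uxx x + I * uxxx x) * F x) x := by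
    intro x
    have h := ((((huxx x).const_mul (-I)).mul (hF x)).sub
      (((hux x).const_mul I).mul (hFx x))).add (((hH x).sub (hF x)).const_mul (2 * z))
    refine h.congr_deriv ?_
    rw [h2]
    linear_combination (ux x * uxx x * F x + ux x ^ 2 * Fx x) * I_sq + 2 * z * h1 x
  exact ⟨_, _, hFx, hFxx, fun x ↦ by ring⟩
end

section
/- Let u : ℝ → ℂ be differentiable, let z, y ∈ ℂ, and let F, G, H : ℝ → ℂ be differentiable functions satisfying for all x ∈ ℝ: F_x = −i u_x F − 2 i z G, H_x = i u_x H + 2 i z G, G_x = i (H − F), F(x) ≠ 0, and y² = z²·G(x)² + z·F(x)·H(x). Define φ(x) = (y − z·G(x)) / F(x). Then φ is differentiable and satisfies the Riccati-type equation φ(x)² − i·φ_x(x) = z + u_x(x)·φ(x) for all x ∈ ℝ. -/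
open Complex

/-- The fundamental meromorphic function `φ = (y - z G)/F` satisfies the
Riccati-type equation `φ² - i φ_x = z + u_x φ`. -/
theorem phi_riccati
    (u ux F Fx G Gx H Hx : ℝ → ℂ) (z y : ℂ)
    (hu : ∀ x : ℝ, HasDerivAt u (ux x) x)
    (hF : ∀ x : ℝ, HasDerivAt F (Fx x) x)
    (hG : ∀ x : ℝ, HasDerivAt G (Gx x) x)
    (hH : ∀ x : ℝ, HasDerivAt H (Hx x) x)
    (h1 : ∀ x : ℝ, Fx x = -I * ux x * F x - 2 * I * z * G x)
    (h2 : ∀ x : ℝ, Hx x = I * ux x * H x + 2 * I * z * G x)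
    (h3 : ∀ x : ℝ, Gx x = I * (H x - F x))
    (hFne : ∀ x : ℝ, F x ≠ 0)
    (hy : ∀ x : ℝ, y ^ 2 = z ^ 2 * G x ^ 2 + z * F x * H x) :
    ∃ φx : ℝ → ℂ,
      (∀ x : ℝ, HasDerivAt (fun x' : ℝ => (y - z * G x') / F x') (φx x) x) ∧
      ∀ x : ℝ, ((y - z * G x) / F x) ^ 2 - I * φx x =
        z + ux x * ((y - z * G x) / F x) := by
  refine ⟨fun x => (-(z * Gx x) * F x - (y - z * G x) * Fx x) / F x ^ 2, fun x => ?_, fun x => ?_⟩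
  · exact (((hG x).const_mul z).const_sub y).div (hF x) (hFne x)
  · have hne := hFne x
    simp only [h1, h3]
    field_simp
    linear_combination hy x +
      (z * (H x - F x) * F x - (y - z * G x) * (ux x * F x + 2 * z * G x)) * I_sq
end

section
/- Let u : ℝ → ℂ be differentiable, let z ∈ ℂ, let φ : ℝ → ℂ be continuous and differentiable satisfying the Riccati-type equation φ(x)² − i·φ_x(x) = z + u_x(x)·φ(x) for all x ∈ ℝ, and fix x₀ ∈ ℝ. Define ψ₁(x) = exp( −(i/2)·(u(x) − u(x₀)) + i·∫_{x₀}^{x} φ(t) dt ) and ψ₂(x) = −φ(x)·ψ₁(x). Then for all x ∈ ℝ: ψ₁'(x) = −(i/2)·u_x(x)·ψ₁(x) − i·ψ₂(x) and ψ₂'(x) = −i·z·ψ₁(x) + (i/2)·u_x(x)·ψ₂(x); that is, the vector Ψ = (ψ₁, ψ₂) satisfies Ψ_x = U Ψ with U(x) = −i · [[u_x(x)/2, 1], [z, −u_x(x)/2]]. -/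
open Complex

/-- The Baker–Akhiezer vector `Ψ = (ψ₁, ψ₂)` built from a Riccati solution `φ`
satisfies `Ψ_x = U Ψ`, i.e. the two scalar first-order equations. -/
theorem baker_akhiezer_first_order
    (u ux φ φx : ℝ → ℂ) (z : ℂ) (x₀ : ℝ)
    (hu : ∀ x : ℝ, HasDerivAt u (ux x) x)
    (hφc : Continuous φ)
    (hφ : ∀ x : ℝ, HasDerivAt φ (φx x) x)
    (hR : ∀ x : ℝ, φ x ^ 2 - I * φx x = z + ux x * φ x)
    (ψ₁ ψ₂ : ℝ → ℂ)
    (hψ₁ : ∀ x : ℝ, ψ₁ x =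
      Complex.exp (-(I / 2) * (u x - u x₀) + I * ∫ t in x₀..x, φ t))
    (hψ₂ : ∀ x : ℝ, ψ₂ x = -φ x * ψ₁ x) :
    ∀ x : ℝ,
      HasDerivAt ψ₁ (-(I / 2) * ux x * ψ₁ x - I * ψ₂ x) x ∧
      HasDerivAt ψ₂ (-I * z * ψ₁ x + (I / 2) * ux x * ψ₂ x) x := by
  intro x
  have hint : HasDerivAt (fun y : ℝ => ∫ t in x₀..y, φ t) (φ x) x :=
    hφc.integral_hasStrictDerivAt x₀ x |>.hasDerivAt
  have h₁ : HasDerivAt ψ₁ (ψ₁ x * (-(I / 2) * ux x + I * φ x)) x := by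
    rw [hψ₁ x, funext hψ₁]
    exact ((((hu x).sub_const (u x₀)).const_mul (-(I / 2))).add (hint.const_mul I)).cexp
  have h₂ : HasDerivAt ψ₂ (-φx x * ψ₁ x + -φ x * (ψ₁ x * (-(I / 2) * ux x + I * φ x))) x := by
    rw [funext hψ₂]
    exact (hφ x).neg.mul h₁
  refine ⟨h₁.congr_deriv ?_, h₂.congr_deriv ?_⟩
  · rw [hψ₂ x]
    ring
  · rw [hψ₂ x]
    linear_combination (-I * ψ₁ x) * hR x - φx x * ψ₁ x * I_sq
end

section
/- Let u : ℝ → ℂ be differentiable, let z, y ∈ ℂ, and let F, G, H : ℝ → ℂ be continuous and differentiable functions satisfying for all x ∈ ℝ: F_x = −i u_x F − 2 i z G, H_x = i u_x H + 2 i z G, G_x = i (H − F), F(x) ≠ 0, and y² = z²·G(x)² + z·F(x)·H(x). Fix x₀ ∈ ℝ, define φ⁺(x) = (y − z·G(x))/F(x), φ⁻(x) = (−y − z·G(x))/F(x), and ψ₁^±(x) = exp( −(i/2)·(u(x) − u(x₀)) + i·∫_{x₀}^{x} φ^±(t) dt ). Then ψ₁⁺(x)·ψ₁⁻(x) = F(x)/F(x₀)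 for all x ∈ ℝ. -/
open Complex

/-- A solution of `F' = E' F` on the real line is determined by its value at one point. -/
theorem eq_mul_exp_sub_of_hasDerivAt {F E E' : ℝ → ℂ}
    (hE : ∀ x, HasDerivAt E (E' x) x) (hF : ∀ x, HasDerivAt F (E' x * F x) x) (x₀ x : ℝ) :
    F x = F x₀ * Complex.exp (E x - E x₀) := by
  have hd (t : ℝ) : HasDerivAt (fun s => F s * Complex.exp (-E s)) 0 t :=
    ((hF t).mul (hE t).neg.cexp).congr_deriv (by simp only [Pi.neg_apply]; ring)
  have hc := is_const_of_deriv_eq_zero (fun t => (hd t).differentiableAt)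
    (fun t => (hd t).deriv) x x₀
  calc F x = F x * Complex.exp (-E x) * Complex.exp (E x) := by
        rw [mul_assoc, ← Complex.exp_add]; simp
    _ = F x₀ * Complex.exp (E x - E x₀) := by
        rw [hc, mul_assoc, ← Complex.exp_add, neg_add_eq_sub]

/-- The product of the two branches of the first Baker–Akhiezer component
equals `F(x)/F(x₀)`. -/
theorem baker_akhiezer_product
    (u ux F Fx G Gx H Hx : ℝ → ℂ) (z y : ℂ) (x₀ : ℝ)
    (hu : ∀ x : ℝ, HasDerivAt u (ux x) x)
    (hFc : Continuous F) (hGc : Continuous G) (hHc : Continuous H)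
    (hF : ∀ x : ℝ, HasDerivAt F (Fx x) x)
    (hG : ∀ x : ℝ, HasDerivAt G (Gx x) x)
    (hH : ∀ x : ℝ, HasDerivAt H (Hx x) x)
    (h1 : ∀ x : ℝ, Fx x = -I * ux x * F x - 2 * I * z * G x)
    (h2 : ∀ x : ℝ, Hx x = I * ux x * H x + 2 * I * z * G x)
    (h3 : ∀ x : ℝ, Gx x = I * (H x - F x))
    (hFne : ∀ x : ℝ, F x ≠ 0)
    (hy : ∀ x : ℝ, y ^ 2 = z ^ 2 * G x ^ 2 + z * F x * H x)
    (ψp ψm : ℝ → ℂ)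
    (hψp : ∀ x : ℝ, ψp x = Complex.exp (-(I / 2) * (u x - u x₀) +
      I * ∫ t in x₀..x, (y - z * G t) / F t))
    (hψm : ∀ x : ℝ, ψm x = Complex.exp (-(I / 2) * (u x - u x₀) +
      I * ∫ t in x₀..x, (-y - z * G t) / F t)) :
    ∀ x : ℝ, ψp x * ψm x = F x / F x₀ := by
  intro x
  have hp : Continuous fun t => (y - z * G t) / F t := by fun_prop (disch := assumption)
  have hm : Continuous fun t => (-y - z * G t) / F t := by fun_prop (disch := assumption)
  have hE (t : ℝ) := (((hu t).const_mul (-I)).add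
    (((hp.integral_hasStrictDerivAt x₀ t).hasDerivAt).const_mul I)).add
    (((hm.integral_hasStrictDerivAt x₀ t).hasDerivAt).const_mul I)
  have key := eq_mul_exp_sub_of_hasDerivAt hE (F := F) (fun t => by
    convert hF t using 1
    rw [h1 t]
    field_simp [hFne t]
    ring) x₀ x
  rw [hψp, hψm, ← Complex.exp_add, key, mul_div_cancel_left₀ _ (hFne x₀)]
  congr 1
  simp only [Pi.add_apply, intervalIntegral.integral_same]
  ring
end

section
/- Let z ∈ ℂ with z ≠ 0 and let u, φ, F̃, G̃, H̃ : ℝ² → ℂ (functions of (x, t)) be twice continuously differentiable. Assume that for all (x, t): (i) φ² − i·φ_x = z + u_x·φ; (ii) F̃_x = −i u_x F̃ − 2 i z G̃; (iii) H̃_x = i u_x H̃ + 2 i z G̃; (iv) u_{xt} = −2 i G̃_x − 2 (H̃ − F̃). Define A = φ_t + (H̃ − F̃) − (i/z)·(φ·F̃)_x. Then A_x + i·(2φ − u_x)·A = 0 identically, i.e., ( ∂_x + i (2φ − u_x) ) ( φ_t + (H̃ − F̃) − (i/z)(φ F̃)_x ) = 0. -/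
open Complex

/-- The key identity `(∂_x + i(2φ - u_x)) (φ_t + (H̃ - F̃) - (i/z)(φ F̃)_x) = 0`
for the time-dependent sGmKdV formalism.  All functions are functions of `(x, t)`,
written in curried form; the named functions `ux, uxx, uxt, φx, φxx, φt, φtx`,
`Ftilx, Ftilxx, Gtilx, Htilx` are the indicated partial derivatives, with
`φtx` the common mixed second partial of `φ` (symmetry of mixed partials holding
since the data is twice continuously differentiable). -/
theorem time_dependent_key_identity
    (z : ℂ) (hz : z ≠ 0)
    (u ux uxx uxt φ φx φxx φt φtx Ftil Ftilx Ftilxx Gtil Gtilx Htil Htilx :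
      ℝ → ℝ → ℂ)
    (hux : ∀ x t : ℝ, HasDerivAt (fun x' : ℝ => u x' t) (ux x t) x)
    (huxx : ∀ x t : ℝ, HasDerivAt (fun x' : ℝ => ux x' t) (uxx x t) x)
    (huxt : ∀ x t : ℝ, HasDerivAt (fun t' : ℝ => ux x t') (uxt x t) t)
    (hφx : ∀ x t : ℝ, HasDerivAt (fun x' : ℝ => φ x' t) (φx x t) x)
    (hφxx : ∀ x t : ℝ, HasDerivAt (fun x' : ℝ => φx x' t) (φxx x t) x)
    (hφt : ∀ x t : ℝ, HasDerivAt (fun t' : ℝ => φ x t') (φt x t) t)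
    (hφtx : ∀ x t : ℝ, HasDerivAt (fun x' : ℝ => φt x' t) (φtx x t) x)
    (hφxt : ∀ x t : ℝ, HasDerivAt (fun t' : ℝ => φx x t') (φtx x t) t)
    (hFtilx : ∀ x t : ℝ, HasDerivAt (fun x' : ℝ => Ftil x' t) (Ftilx x t) x)
    (hFtilxx : ∀ x t : ℝ, HasDerivAt (fun x' : ℝ => Ftilx x' t) (Ftilxx x t) x)
    (hGtilx : ∀ x t : ℝ, HasDerivAt (fun x' : ℝ => Gtil x' t) (Gtilx x t) x)
    (hHtilx : ∀ x t : ℝ, HasDerivAt (fun x' : ℝ => Htil x' t) (Htilx x t) x)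
    (hRic : ∀ x t : ℝ, φ x t ^ 2 - I * φx x t = z + ux x t * φ x t)
    (hii : ∀ x t : ℝ, Ftilx x t = -I * ux x t * Ftil x t - 2 * I * z * Gtil x t)
    (hiii : ∀ x t : ℝ, Htilx x t = I * ux x t * Htil x t + 2 * I * z * Gtil x t)
    (hiv : ∀ x t : ℝ, uxt x t = -2 * I * Gtilx x t - 2 * (Htil x t - Ftil x t)) :
    ∀ x t : ℝ,
      (φtx x t + (Htilx x t - Ftilx x t) -
          I / z * (φxx x t * Ftil x t + 2 * φx x t * Ftilx x t + φ x t * Ftilxx x t)) +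
        I * (2 * φ x t - ux x t) *
          (φt x t + (Htil x t - Ftil x t) -
            I / z * (φx x t * Ftil x t + φ x t * Ftilx x t)) = 0 := by
  intro x t
  have hRic_t : 2 * φ x t * φt x t - I * φtx x t = uxt x t * φ x t + ux x t * φt x t := by
    have hl := ((hφt x t).pow 2).sub ((hφxt x t).const_mul I)
    have hr := ((huxt x t).mul (hφt x t)).const_add z
    have hfun : (fun t' : ℝ => φ x t' ^ 2 - I * φx x t') =
        fun t' : ℝ => z + ux x t' * φ x t' := funext (hRic x)
    have h := hl.unique (hr.congr_of_eventuallyEq (Filter.Eventually.of_forall (congrFun hfun)))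
    norm_num at h
    exact h
  have hRic_x : 2 * φ x t * φx x t - I * φxx x t = uxx x t * φ x t + ux x t * φx x t := by
    have hl := ((hφx x t).pow 2).sub ((hφxx x t).const_mul I)
    have hr := ((huxx x t).mul (hφx x t)).const_add z
    have hfun : (fun x' : ℝ => φ x' t ^ 2 - I * φx x' t) =
        fun x' : ℝ => z + ux x' t * φ x' t := funext fun x' => hRic x' t
    have h := hl.unique (hr.congr_of_eventuallyEq (Filter.Eventually.of_forall (congrFun hfun)))
    norm_num at h
    exact h
  have hFxx : Ftilxx x t =
      -I * (uxx x t * Ftil x t + ux x t * Ftilx x t) - 2 * I * z * Gtilx x t := by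
    have hr := (((huxx x t).mul (hFtilx x t)).const_mul (-I)).sub
      ((hGtilx x t).const_mul (2 * I * z))
    refine (hFtilxx x t).unique (hr.congr_of_eventuallyEq (Filter.Eventually.of_forall ?_))
    intro x'
    simp [hii x' t, mul_assoc]
  have hI : I * I = -1 := I_mul_I
  have hφx_eq : φx x t = -I * (φ x t ^ 2 - z - ux x t * φ x t) := by
    linear_combination I * hRic x t + φx x t * hI
  have hφxx_eq : φxx x t = -I * (2 * φ x t - ux x t) * φx x t + I * uxx x t * φ x t := by
    linear_combination I * hRic_x + φxx x t * hI
  have hφtx_eq : φtx x t = -I * (2 * φ x t - ux x t) * φt x t + I * uxt x t * φ x t := by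
    linear_combination I * hRic_t + φtx x t * hI
  have hF : φxx x t * Ftil x t + 2 * φx x t * Ftilx x t + φ x t * Ftilxx x t +
      I * (2 * φ x t - ux x t) * (φx x t * Ftil x t + φ x t * Ftilx x t) =
      2 * I * z * (Ftilx x t - φ x t * Gtilx x t) := by
    rw [hφxx_eq, hFxx]
    linear_combination 2 * Ftilx x t * hφx_eq
  have hzz : I / z * (2 * I * z) = -2 := by
    field_simp
    linear_combination hI
  rw [hφtx_eq, hiv, hiii]
  linear_combination (-(I / z)) * hF - (Ftilx x t - φ x t * Gtilx x t) * hzz + hii x t -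
    2 * φ x t * Gtilx x t * hI
end

section
/- Let n ∈ ℕ, let u : ℝ → ℂ be differentiable, let G : ℂ × ℝ → ℂ, and let μ₁, …, μ_n : ℝ → ℂ be differentiable. Define F(z, x) = ∏_{j=1}^{n} (z − μ_j(x)) and assume that for all z ∈ ℂ and x ∈ ℝ: F_x(z, x) = −i·u_x(x)·F(z, x) − 2·i·z·G(z, x). Then the function x ↦ e^{i·u(x)} · ∏_{j=1}^{n} μ_j(x) is constant on ℝ; equivalently, there exists α ∈ ℂ such that (−1)^n ∏_{j=1}^{n} μ_j(x) = α·e^{−i·u(x)} for all x ∈ ℝ. -/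
open Complex

/-- A solution of the linear equation `P' = -i u' P` is a constant multiple of `e^{-iu}`. -/
theorem exists_eq_const_mul_exp_neg_of_hasDerivAt {u ux P : ℝ → ℂ}
    (hu : ∀ x, HasDerivAt u (ux x) x)
    (hP : ∀ x, HasDerivAt P (-I * ux x * P x) x) :
    ∃ α : ℂ, ∀ x, P x = α * Complex.exp (-I * u x) := by
  have hd (x : ℝ) : HasDerivAt (fun y => Complex.exp (I * u y) * P y) 0 x := by
    refine (((hu x).const_mul I).cexp.mul (hP x)).congr_deriv ?_
    ring
  refine ⟨Complex.exp (I * u 0) * P 0, fun x => ?_⟩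
  have hc := is_const_of_deriv_eq_zero (fun y => (hd y).differentiableAt)
    (fun y => (hd y).deriv) 0 x
  rw [hc, mul_right_comm, ← Complex.exp_add]
  simp

/-- Trace formula: if `F(z,x) = ∏ (z - μ_j(x))` satisfies
`F_x = -i u_x F - 2 i z G`, then `e^{iu} ∏ μ_j` is constant; equivalently
`(-1)^n ∏ μ_j(x) = α e^{-iu(x)}` for some constant `α`. -/
theorem trace_formula_stationary
    (n : ℕ) (hn : 0 < n) (u ux : ℝ → ℂ) (G : ℂ → ℝ → ℂ)
    (μ μ' : Fin n → ℝ → ℂ)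
    (hu : ∀ x : ℝ, HasDerivAt u (ux x) x)
    (hμ : ∀ (j : Fin n) (x : ℝ), HasDerivAt (μ j) (μ' j x) x)
    (hF : ∀ (z : ℂ) (x : ℝ),
      HasDerivAt (fun x' : ℝ => ∏ j, (z - μ j x'))
        (-I * ux x * (∏ j, (z - μ j x)) - 2 * I * z * G z x) x) :
    (∃ c : ℂ, ∀ x : ℝ, Complex.exp (I * u x) * ∏ j, μ j x = c) ∧
      ∃ α : ℂ, ∀ x : ℝ,
        (-1 : ℂ) ^ n * ∏ j, μ j x = α * Complex.exp (-I * u x) := by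
  have hprod (x : ℝ) : ∏ j, (0 - μ j x) = (-1 : ℂ) ^ n * ∏ j, μ j x := by
    simp [Finset.prod_neg]
  obtain ⟨α, hα⟩ : ∃ α : ℂ, ∀ x : ℝ,
      (-1 : ℂ) ^ n * ∏ j, μ j x = α * Complex.exp (-I * u x) := by
    refine exists_eq_const_mul_exp_neg_of_hasDerivAt hu fun x => ?_
    simpa only [hprod, mul_zero, zero_mul, sub_zero] using hF 0 x
  refine ⟨⟨(-1) ^ n * α, fun x => ?_⟩, α, hα⟩
  have hsq : (-1 : ℂ) ^ n * (-1) ^ n = 1 := by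
    rw [← mul_pow]
    simp
  have hexp : Complex.exp (I * u x) * Complex.exp (-I * u x) = 1 := by
    rw [← Complex.exp_add]
    simp
  calc Complex.exp (I * u x) * ∏ j, μ j x
      = Complex.exp (I * u x) * ((-1) ^ n * ((-1 : ℂ) ^ n * ∏ j, μ j x)) := by
        rw [← mul_assoc ((-1 : ℂ) ^ n), hsq, one_mul]
    _ = (-1) ^ n * α * (Complex.exp (I * u x) * Complex.exp (-I * u x)) := by
        rw [hα]
        ring
    _ = (-1) ^ n * α := by rw [hexp, mul_one]
end

section
/- Let n ∈ ℕ, let u : ℝ → ℂ be differentiable, let G : ℂ × ℝ → ℂ, and let μ₁, …, μ_n : ℝ → ℂ be differentiable functions such that μ₁(x), …, μ_n(x) are pairwise distinct for every x ∈ ℝ. Define F(z, x) = ∏_{j=1}^{n} (z − μ_j(x)) and assume that for all z ∈ ℂ and x ∈ ℝ: F_x(z, x) = −i·u_x(x)·F(z, x) − 2·i·z·G(z, x). Then the zeros satisfy the Dubrovin-type equations: for each j ∈ {1, …, n} and all x ∈ ℝ, μ_j'(x) · ∏_{ℓ ≠ j} (μ_j(x) − μ_ℓ(x)) = 2·i·μ_j(x)·G(μ_j(x),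 x). -/
open Complex

/-- Dubrovin-type equations for the zeros `μ_j` of `F`. -/
theorem dubrovin_stationary
    (n : ℕ) (hn : 0 < n) (u ux : ℝ → ℂ) (G : ℂ → ℝ → ℂ)
    (μ μ' : Fin n → ℝ → ℂ)
    (hdist : ∀ (x : ℝ) (j k : Fin n), j ≠ k → μ j x ≠ μ k x)
    (hu : ∀ x : ℝ, HasDerivAt u (ux x) x)
    (hμ : ∀ (j : Fin n) (x : ℝ), HasDerivAt (μ j) (μ' j x) x)
    (hF : ∀ (z : ℂ) (x : ℝ),
      HasDerivAt (fun x' : ℝ => ∏ j, (z - μ j x'))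
        (-I * ux x * (∏ j, (z - μ j x)) - 2 * I * z * G z x) x) :
    ∀ (j : Fin n) (x : ℝ),
      μ' j x * ∏ ℓ ∈ Finset.univ.erase j, (μ j x - μ ℓ x) =
        2 * I * μ j x * G (μ j x) x := by
  intro j x
  have hsplit (x' : ℝ) : ∏ ℓ, (μ j x - μ ℓ x') =
      (μ j x - μ j x') * ∏ ℓ ∈ Finset.univ.erase j, (μ j x - μ ℓ x') :=
    (Finset.mul_prod_erase _ _ (Finset.mem_univ j)).symm
  have hprod : DifferentiableAt ℝ
      (fun x' : ℝ => ∏ ℓ ∈ Finset.univ.erase j, (μ j x - μ ℓ x')) x :=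
    DifferentiableAt.fun_finsetProd fun ℓ _ => ((hμ ℓ x).const_sub (μ j x)).differentiableAt
  have hderiv := ((hμ j x).const_sub (μ j x)).fun_mul hprod.hasDerivAt
  have hF' := hF (μ j x) x
  simp only [hsplit] at hF'
  linear_combination (hF'.unique hderiv)
end

section
/- Let n ∈ ℕ, let G, F̃ : ℂ × ℝ → ℂ, and let μ₁, …, μ_n : ℝ → ℂ be differentiable functions of t such that μ₁(t), …, μ_n(t) are pairwise distinct for every t. Define F(z, t) = ∏_{j=1}^{n} (z − μ_j(t)) and assume that for all z ∈ ℂ and all t: F_t(z, t) = 2·( G(z, t)·F̃(z, t) − G̃(z, t)·F(z, t) ) for some function G̃ : ℂ × ℝ → ℂ. Then for each j ∈ {1, …, n} and all t: μ_j'(t) · ∏_{ℓ ≠ j} (μ_j(t) − μ_ℓ(t)) = −2·F̃(μ_j(t), t)·G(μ_j(t), t). -/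
open Complex

/-- Time-dependent Dubrovin-type equations for the zeros `μ_j` of `F`. -/
theorem dubrovin_time_dependent
    (n : ℕ) (hn : 0 < n) (G Ftil Gtil : ℂ → ℝ → ℂ)
    (μ μ' : Fin n → ℝ → ℂ)
    (hdist : ∀ (t : ℝ) (j k : Fin n), j ≠ k → μ j t ≠ μ k t)
    (hμ : ∀ (j : Fin n) (t : ℝ), HasDerivAt (μ j) (μ' j t) t)
    (hF : ∀ (z : ℂ) (t : ℝ),
      HasDerivAt (fun t' : ℝ => ∏ j, (z - μ j t'))
        (2 * (G z t * Ftil z t - Gtil z t * ∏ j, (z - μ j t))) t) :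
    ∀ (j : Fin n) (t : ℝ),
      μ' j t * ∏ ℓ ∈ Finset.univ.erase j, (μ j t - μ ℓ t) =
        -2 * Ftil (μ j t) t * G (μ j t) t := by
  intro j t
  have hprod := HasDerivAt.fun_finsetProd (u := Finset.univ)
    fun i _ => (hμ i t).const_sub (μ j t)
  have heq := hprod.unique (hF (μ j t) t)
  rw [Finset.sum_eq_single_of_mem j (Finset.mem_univ j),
    Finset.prod_eq_zero (Finset.mem_univ j) (sub_self (μ j t))] at heq
  · rw [smul_eq_mul] at heq
    linear_combination -heq
  · intro i _ hij
    rw [Finset.prod_eq_zero (Finset.mem_erase.mpr ⟨hij.symm, Finset.mem_univ j⟩)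
      (sub_self (μ j t)), zero_smul]
end

section
/- Let u : ℝ → ℂ be differentiable, let g : ℝ → ℂ be twice differentiable, and let f⁺, f⁻ : ℝ → ℂ be differentiable functions satisfying for all x ∈ ℝ: f⁺_x = (i/2)·(g_xx − i·u_x·g_x) and f⁻_x = −(i/2)·(g_xx + i·u_x·g_x). If moreover (i/2)·( f⁺_x + i·u_x·f⁺ ) = (i/2)·( −f⁻_x + i·u_x·f⁻ ) on ℝ, then u_x(x)·( g_x(x) − i·( f⁻(x) − f⁺(x) ) ) = 0 for all x ∈ ℝ. In particular, at every point where u_x(x) ≠ 0 one has g_x(x) = i·( f⁻(x) − f⁺(x) ). -/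
open Complex

/-- Second part of the compatibility lemma: from `g⁺ = g⁻` one deduces
`u_x (g_x - i(f⁻ - f⁺)) = 0`; in particular `g_x = i(f⁻ - f⁺)` wherever
`u_x` does not vanish. -/
theorem recursion_relation_from_compatibility
    (u ux g gx gxx fp fpx fm fmx : ℝ → ℂ)
    (hu : ∀ x : ℝ, HasDerivAt u (ux x) x)
    (hg : ∀ x : ℝ, HasDerivAt g (gx x) x)
    (hgx : ∀ x : ℝ, HasDerivAt gx (gxx x) x)
    (hfp : ∀ x : ℝ, HasDerivAt fp (fpx x) x)
    (hfm : ∀ x : ℝ, HasDerivAt fm (fmx x) x)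
    (h1 : ∀ x : ℝ, fpx x = I / 2 * (gxx x - I * ux x * gx x))
    (h2 : ∀ x : ℝ, fmx x = -(I / 2) * (gxx x + I * ux x * gx x))
    (heq : ∀ x : ℝ,
      I / 2 * (fpx x + I * ux x * fp x) =
        I / 2 * (-fmx x + I * ux x * fm x)) :
    ∀ x : ℝ,
      ux x * (gx x - I * (fm x - fp x)) = 0 ∧
      (ux x ≠ 0 → gx x = I * (fm x - fp x)) := by
  intro x
  have hI : I / 2 ≠ 0 := div_ne_zero I_ne_zero two_ne_zero
  have h := mul_left_cancel₀ hI (heq x)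
  rw [h1, h2] at h
  have key : ux x * (gx x - I * (fm x - fp x)) = 0 := by
    linear_combination h + ux x * gx x * I_sq
  exact ⟨key, fun hx => sub_eq_zero.mp ((mul_eq_zero.mp key).resolve_left hx)⟩
end

section
/- Let u : ℝ → ℂ be differentiable, continuous, and nonconstant, let α⁺, α⁻ ∈ ℂ with α⁺ ≠ 0 and α⁻ ≠ 0, and let g : ℝ → ℂ be twice differentiable with g_x(x) = i·( α⁻·e^{i·u(x)} − α⁺·e^{−i·u(x)} ) for all x ∈ ℝ. Let f⁺, f⁻ : ℝ → ℂ be differentiable with f⁺_x = (i/2)·(g_xx − i·u_x·g_x) and f⁻_x = −(i/2)·(g_xx + i·u_x·g_x), and assume the constraint f⁺(x)·f⁻(x) = α⁺·α⁻ for all x ∈ ℝ. Then f⁺(x) = α⁺·e^{−i·u(x)} and f⁻(x) = α⁻·e^{i·u(x)} for all x ∈ ℝ. -/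
open Complex

/-- A continuous function on `ℝ` whose values all satisfy one nonzero polynomial equation is
constant. -/
theorem eq_of_continuous_of_isRoot {f : ℝ → ℂ} (hf : Continuous f) {p : Polynomial ℂ}
    (hp : p ≠ 0) (hroot : ∀ x, p.IsRoot (f x)) (x y : ℝ) : f x = f y := by
  have hfin : (Set.range f).Finite :=
    (Polynomial.finite_setOfPred_isRoot hp).subset (Set.range_subset_iff.2 hroot)
  by_contra hne
  exact (isPreconnected_range hf).infinite_of_nontrivial
    ⟨f x, ⟨x, rfl⟩, f y, ⟨y, rfl⟩, hne⟩ hfin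

/-- If `exp (I * u)` is constant, then so is the differentiable function `u`. -/
theorem eq_of_exp_I_mul_const {u ux : ℝ → ℂ} (hu : ∀ x : ℝ, HasDerivAt u (ux x) x)
    (hexp : ∀ x y, Complex.exp (I * u x) = Complex.exp (I * u y)) (x y : ℝ) : u x = u y := by
  refine is_const_of_deriv_eq_zero (fun t => (hu t).differentiableAt) (fun t => ?_) x y
  have hE := ((hu t).const_mul I).cexp
  have hconst : (fun s => Complex.exp (I * u s)) = fun _ => Complex.exp (I * u t) :=
    funext fun s => hexp s t
  rw [hconst] at hE
  have h0 := hE.unique (hasDerivAt_const t _)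
  rw [(hu t).deriv]
  simpa [Complex.exp_ne_zero, I_ne_zero] using h0

/-- Two functions on `ℝ` with the same derivative differ by a constant. -/
theorem exists_eq_add_const_of_hasDerivAt {f h f' : ℝ → ℂ}
    (hf : ∀ x, HasDerivAt f (f' x) x) (hh : ∀ x, HasDerivAt h (f' x) x) :
    ∃ c, ∀ x, f x = h x + c := by
  refine ⟨f 0 - h 0, fun x => ?_⟩
  have hd : ∀ t, HasDerivAt (fun s => f s - h s) 0 t := fun t =>
    sub_self (f' t) ▸ (hf t).sub (hh t)
  have := is_const_of_deriv_eq_zero (fun t => (hd t).differentiableAt) (fun t => (hd t).deriv) x 0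
  linear_combination this

/-- Identification of the top recursion coefficients: under the `n`-th
stationary sGmKdV equation and the constraint `f⁺ f⁻ = α⁺ α⁻`, one has
`f⁺ = α⁺ e^{-iu}` and `f⁻ = α⁻ e^{iu}`. -/
theorem top_coefficients_identified
    (u ux g gx gxx fp fpx fm fmx : ℝ → ℂ) (αp αm : ℂ)
    (hαp : αp ≠ 0) (hαm : αm ≠ 0)
    (hu : ∀ x : ℝ, HasDerivAt u (ux x) x)
    (huc : Continuous u)
    (hunc : ∃ x y : ℝ, u x ≠ u y)
    (hg : ∀ x : ℝ, HasDerivAt g (gx x) x)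
    (hgx : ∀ x : ℝ, HasDerivAt gx (gxx x) x)
    (hsG : ∀ x : ℝ, gx x =
      I * (αm * Complex.exp (I * u x) - αp * Complex.exp (-I * u x)))
    (hfp : ∀ x : ℝ, HasDerivAt fp (fpx x) x)
    (hfm : ∀ x : ℝ, HasDerivAt fm (fmx x) x)
    (h1 : ∀ x : ℝ, fpx x = I / 2 * (gxx x - I * ux x * gx x))
    (h2 : ∀ x : ℝ, fmx x = -(I / 2) * (gxx x + I * ux x * gx x))
    (hconstr : ∀ x : ℝ, fp x * fm x = αp * αm) :
    ∀ x : ℝ,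
      fp x = αp * Complex.exp (-I * u x) ∧
      fm x = αm * Complex.exp (I * u x) := by
  have hE : ∀ x, HasDerivAt (fun s => Complex.exp (I * u s))
      (Complex.exp (I * u x) * (I * ux x)) x := fun x => ((hu x).const_mul I).cexp
  have hF : ∀ x, HasDerivAt (fun s => Complex.exp (-I * u s))
      (Complex.exp (-I * u x) * (-I * ux x)) x := fun x => ((hu x).const_mul (-I)).cexp
  have hEF : ∀ x, Complex.exp (I * u x) * Complex.exp (-I * u x) = 1 := fun x => by
    rw [← Complex.exp_add]
    simp
  have hgxx : ∀ x, gxx x = I * (αm * (Complex.exp (I * u x) * (I * ux x)) -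
      αp * (Complex.exp (-I * u x) * (-I * ux x))) := fun x => by
    refine (hgx x).unique ?_
    rw [funext hsG]
    exact (((hE x).const_mul αm).sub ((hF x).const_mul αp)).const_mul I
  have hfp' : ∀ x, fpx x = αp * (Complex.exp (-I * u x) * (-I * ux x)) := fun x => by
    rw [h1, hgxx, hsG]
    linear_combination (αp * Complex.exp (-I * u x) * ux x * I) * I_sq
  have hfm' : ∀ x, fmx x = αm * (Complex.exp (I * u x) * (I * ux x)) := fun x => by
    rw [h2, hgxx, hsG]
    linear_combination (-αm * Complex.exp (I * u x) * ux x * I) * I_sq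
  obtain ⟨c, hc⟩ := exists_eq_add_const_of_hasDerivAt hfp
    (fun x => (hfp' x).symm ▸ (hF x).const_mul αp)
  obtain ⟨d, hd⟩ := exists_eq_add_const_of_hasDerivAt hfm
    (fun x => (hfm' x).symm ▸ (hE x).const_mul αm)
  have hquad : ∀ x, c * αm * Complex.exp (I * u x) ^ 2 + c * d * Complex.exp (I * u x) +
      d * αp = 0 := fun x => by
    have h := hconstr x
    rw [hc, hd] at h
    linear_combination Complex.exp (I * u x) * h -
      (αp * αm * Complex.exp (I * u x) + d * αp) * hEF x
  have hc0 : c = 0 := by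
    by_contra hne
    obtain ⟨x, y, hxy⟩ := hunc
    let p : Polynomial ℂ := .C (c * αm) * .X ^ 2 + .C (c * d) * .X + .C (d * αp)
    have hp : p ≠ 0 := fun h => by
      have hcoeff : p.coeff 2 = 0 := by rw [h, Polynomial.coeff_zero]
      simp [p, -map_mul, hne, hαm] at hcoeff
    refine hxy (eq_of_exp_I_mul_const hu (eq_of_continuous_of_isRoot (p := p) ?_ hp ?_) x y)
    · fun_prop
    · intro t
      simpa [p, Polynomial.IsRoot] using hquad t
  have hd0 : d = 0 := by
    have h := hquad 0
    simpa [hc0, hαp] using h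
  intro x
  exact ⟨by rw [hc, hc0, add_zero], by rw [hd, hd0, add_zero]⟩
end
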